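/- Let f be a C^∞ map of a compact interval or circle N with all critical points non-flat. Then there exist a neighbourhood F of f in the C^∞ topology and a function ρ(ε) such that: if g ∈ F and J ⊂ T are intervals on which g is a diffeomorphism, then D(T, J) < ρ(D(g(T), g(J))). Moreover ρ(ε) → 0 as ε → 0. -/

import Mathlib

open Set Filter Topology MeasureTheory

noncomputable section

/-- The length of a set of reals (its Lebesgue measure). -/
def slen (S : Set ℝ) : ℝ := (volume S).toReal

/-- The cross-ratio `D(T,J)` for intervals `T = [t1,t2] ⊇ J = [j1,j2]`. -/
def crossRatio (t1 j1 j2 t2 : ℝ) : ℝ :=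
  ((t2 - t1) * (j2 - j1)) / ((j1 - t1) * (t2 - j2))

/-- The cross-ratio distortion `B(f,T,J)` for `T = [t1,t2] ⊇ J = [j1,j2]`. -/
def crDist (f : ℝ → ℝ) (t1 j1 j2 t2 : ℝ) : ℝ :=
  crossRatio (f t1) (f j1) (f j2) (f t2) / crossRatio t1 j1 j2 t2

/-- The Schwarzian derivative of `f`. -/
def schwarzian (f : ℝ → ℝ) (x : ℝ) : ℝ :=
  iteratedDeriv 3 f x / deriv f x - (3 / 2) * (iteratedDeriv 2 f x / deriv f x) ^ 2

/-- The `l`-scaling `lI` of the interval `I` with endpoints `x ≤ y`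
(same centre, half-width multiplied by `l`). -/
def scaledIcc (l x y : ℝ) : Set ℝ :=
  Icc ((x + y) / 2 - l * (y - x) / 2) ((x + y) / 2 + l * (y - x) / 2)

/-- The `l`-scaling of a bounded interval given as a set. -/
def scaledSet (l : ℝ) (S : Set ℝ) : Set ℝ := scaledIcc l (sInf S) (sSup S)

/-- `p` is a periodic point of `g` of (exact) period `n`. -/
def PeriodicPt (g : ℝ → ℝ) (p : ℝ) (n : ℕ) : Prop :=
  0 < n ∧ g^[n] p = p ∧ ∀ m, 0 < m → m < n → g^[m] p ≠ p

/-- The forward orbit of `p` under `g`. -/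
def orbitSet (g : ℝ → ℝ) (p : ℝ) : Set ℝ := Set.range fun k => g^[k] p

/-- The iterates of `x` converge to the set `O`. -/
def ConvergesToOrbit (g : ℝ → ℝ) (x : ℝ) (O : Set ℝ) : Prop :=
  Tendsto (fun k => Metric.infDist (g^[k] x) O) atTop (nhds 0)

/-- The basin of attraction of the set `O`. -/
def Basin (g : ℝ → ℝ) (O : Set ℝ) : Set ℝ := {x | ConvergesToOrbit g x O}

/-- The immediate basin of attraction of `O` within `N`: the union of the connected
components of the basin which contain points of `O`. -/
def ImmBasinIn (g : ℝ → ℝ) (N : Set ℝ) (O : Set ℝ) : Set ℝ :=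
  ⋃ y ∈ O, connectedComponentIn (Basin g O ∩ N) y

/-- `p` is an attracting periodic point of period `n` for the map `g : N → N`. -/
def AttractingIn (g : ℝ → ℝ) (N : Set ℝ) (p : ℝ) (n : ℕ) : Prop :=
  PeriodicPt g p n ∧
    ∃ U : Set ℝ, IsOpen U ∧ p ∈ U ∧ ∀ x ∈ U ∩ N, ConvergesToOrbit g x (orbitSet g p)

/-- `p` is a neutral periodic point of `g`. -/
def NeutralPeriodicPt (g : ℝ → ℝ) (p : ℝ) (n : ℕ) : Prop :=
  0 < n ∧ g^[n] p = p ∧ |deriv (g^[n]) p| = 1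

/-- `g` is `η`-close to `f` in the `C^k` topology on `N`. -/
def CkClose (k : ℕ) (f g : ℝ → ℝ) (N : Set ℝ) (η : ℝ) : Prop :=
  ∀ i ≤ k, ∀ x ∈ N, |iteratedDeriv i g x - iteratedDeriv i f x| ≤ η

/-- `{T k}_{k=0}^m` is a chain for the map `g : N → N`:
each `T k` is a connected component of `g⁻¹(T (k+1))` (within `N`). -/
def IsChainIn (g : ℝ → ℝ) (N : Set ℝ) (m : ℕ) (T : ℕ → Set ℝ) : Prop :=
  ∀ k < m, (T k).Nonempty ∧ ∀ x ∈ T k, T k = connectedComponentIn (g ⁻¹' T (k + 1) ∩ N) x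

/-- `[u,v]` is a periodic interval of period `n` for `g`. -/
def IsPeriodicInterval (g : ℝ → ℝ) (u v : ℝ) (n : ℕ) : Prop :=
  u ≤ v ∧ 0 < n ∧ g^[n] '' Icc u v = Icc u v ∧ InjOn (g^[n]) (Icc u v)

/-- The periodic points of `g` lying in `S`. -/
def periodicPtsIn (g : ℝ → ℝ) (S : Set ℝ) : Set ℝ :=
  {x ∈ S | ∃ m : ℕ, 0 < m ∧ g^[m] x = x}

/-- A pack of periodic points of `g`: the set of all periodic points in some closed
(possibly degenerate) periodic interval such that no larger periodic interval
contains more periodic points. -/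
def IsPack (g : ℝ → ℝ) (P : Set ℝ) : Prop :=
  ∃ u v n, IsPeriodicInterval g u v n ∧ P = periodicPtsIn g (Icc u v) ∧
    ∀ u' v' n', Icc u v ⊆ Icc u' v' → IsPeriodicInterval g u' v' n' →
      periodicPtsIn g (Icc u' v') = P

/-- `f : N → N` has a wandering interval: a nondegenerate interval whose iterates are
pairwise disjoint and which is not contained in the basin of a periodic attractor. -/
def HasWanderingInterval (f : ℝ → ℝ) (N : Set ℝ) : Prop :=
  ∃ u v : ℝ, u < v ∧ Ioo u v ⊆ N ∧
    (∀ m n : ℕ, m ≠ n → Disjoint (f^[m] '' Ioo u v) (f^[n] '' Ioo u v)) ∧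
    ¬ ∃ p ∈ N, ∃ k : ℕ, AttractingIn f N p k ∧
        ∀ x ∈ Ioo u v, ConvergesToOrbit f x (orbitSet f p)

/-- `n` is the orientation preserving period of the periodic point `p`: it is `2m` if
`Dg^m(p) < 0` and `m` if `Dg^m(p) ≥ 0`, where `m` is the period of `p`. -/
def OrientationPreservingPeriod (g : ℝ → ℝ) (p : ℝ) (n : ℕ) : Prop :=
  ∃ m : ℕ, PeriodicPt g p m ∧
    ((deriv (g^[m]) p < 0 ∧ n = 2 * m) ∨ (0 ≤ deriv (g^[m]) p ∧ n = m))

open scoped ContDiff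

/-- Mean value theorem for iterated forward differences. -/
lemma exists_fwdDiff_iter_eq_iteratedDeriv {h : ℝ} (hh : 0 < h) (n : ℕ) (x : ℝ) {g : ℝ → ℝ}
    (hg : ContDiff ℝ ∞ g) :
    ∃ z ∈ Icc x (x + n * h), (fwdDiff h)^[n] g x = h ^ n * iteratedDeriv n g z := by
  induction n generalizing g with
  | zero => exact ⟨x, by simp, by simp⟩
  | succ n ih =>
    have hshift : ContDiff ℝ ∞ (fun z ↦ g (z + h)) := by fun_prop
    obtain ⟨z, hz, hzeq⟩ := ih (g := fwdDiff h g) (hshift.sub hg)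
    have hdiff : Differentiable ℝ (iteratedDeriv n g) :=
      hg.differentiable_iteratedDeriv n (by exact_mod_cast ENat.natCast_lt_top n)
    have hsub : iteratedDeriv n (fwdDiff h g) z = iteratedDeriv n g (z + h) - iteratedDeriv n g z := by
      have h1 : fwdDiff h g = fun y ↦ g (y + h) - g y := rfl
      have hn : ((n : ℕ) : ℕ∞ω) ≤ ∞ := by exact_mod_cast le_top
      rw [h1, iteratedDeriv_fun_sub (hshift.contDiffAt.of_le hn) (hg.contDiffAt.of_le hn),
        iteratedDeriv_comp_add_const]
    obtain ⟨w, hw, hweq⟩ := exists_deriv_eq_slope (iteratedDeriv n g)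
      (show z < z + h by linarith) hdiff.continuous.continuousOn hdiff.differentiableOn
    refine ⟨w, ⟨by linarith [hz.1, hw.1], ?_⟩, ?_⟩
    · push_cast
      linarith [hz.2, hw.2]
    · rw [Function.iterate_succ_apply, hzeq, hsub, iteratedDeriv_succ, hweq, add_sub_cancel_left]
      field_simp
      ring

lemma abs_fwdDiff_iter_le {u : ℝ → ℝ} {h r : ℝ} (n : ℕ) (y : ℝ)
    (hu : ∀ k ≤ n, |u (y + k * h)| ≤ r) : |(fwdDiff h)^[n] u y| ≤ 2 ^ n * r := by
  induction n generalizing y with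
  | zero => simpa using hu 0 le_rfl
  | succ n ih =>
    have h1 := ih (y + h) fun k hk ↦ by
      have := hu (k + 1) (by omega)
      push_cast at this
      convert this using 3
      ring
    have h2 := ih y fun k hk ↦ hu k (by omega)
    rw [Function.iterate_succ_apply', fwdDiff, pow_succ]
    linarith [abs_sub ((fwdDiff h)^[n] u (y + h)) ((fwdDiff h)^[n] u y)]

lemma abs_le_abs_fwdDiff_iter_add {u : ℝ → ℝ} {h r : ℝ} (hr : 0 ≤ r) (n : ℕ) (y : ℝ)
    (hu : ∀ k, 1 ≤ k → k ≤ n → |u (y + k * h)| ≤ r) :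
    |u y| ≤ |(fwdDiff h)^[n] u y| + 2 ^ n * r := by
  induction n with
  | zero => simpa using hr
  | succ n ih =>
    have h1 := abs_fwdDiff_iter_le (u := u) (h := h) n (y + h) fun k hk ↦ by
      have := hu (k + 1) (by omega) (by omega)
      push_cast at this
      convert this using 3
      ring
    have h2 := ih fun k hk hk' ↦ hu k hk (by omega)
    have h3 := abs_sub_abs_le_abs_sub ((fwdDiff h)^[n] u y) ((fwdDiff h)^[n] u (y + h))
    rw [abs_sub_comm] at h3
    rw [Function.iterate_succ_apply', fwdDiff, pow_succ]
    linarith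

/-- A monotone function whose derivative of order `n + 1` is bounded below grows definitely. -/
lemma le_sub_of_le_abs_iteratedDeriv {g : ℝ → ℝ} (hg : ContDiff ℝ ∞ g) {n : ℕ} {x h m : ℝ}
    (hh : 0 < h) (hmono : MonotoneOn g (Icc x (x + (n + 1) * h)))
    (hm : ∀ z ∈ Icc x (x + (n + 1) * h), m ≤ |iteratedDeriv (n + 1) g z|) :
    m * h ^ (n + 1) ≤ 2 ^ n * (g (x + (n + 1) * h) - g x) := by
  obtain ⟨z, hz, hzeq⟩ := exists_fwdDiff_iter_eq_iteratedDeriv hh (n + 1) x hg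
  push_cast at hz
  have hle : |(fwdDiff h)^[n] (fwdDiff h g) x| ≤ 2 ^ n * (g (x + (n + 1) * h) - g x) := by
    refine abs_fwdDiff_iter_le n x fun k hk ↦ ?_
    have hk0 : 0 ≤ (k : ℝ) * h := by positivity
    have hkn : (k : ℝ) * h ≤ n * h := by gcongr
    have e1 := hmono (a := x) (b := x + k * h) ⟨le_rfl, by nlinarith⟩
      ⟨by linarith, by nlinarith⟩ (by linarith)
    have e2 := hmono (a := x + k * h) (b := x + k * h + h)
      ⟨by linarith, by nlinarith⟩ ⟨by linarith, by nlinarith⟩ (by linarith)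
    have e3 := hmono (a := x + k * h + h) (b := x + (n + 1) * h)
      ⟨by linarith, by nlinarith⟩ ⟨by nlinarith, by nlinarith⟩ (by nlinarith)
    rw [fwdDiff, abs_of_nonneg (by linarith)]
    linarith
  rw [← Function.iterate_succ_apply, hzeq, abs_mul, abs_of_pos (pow_pos hh _), mul_comm] at hle
  exact (mul_le_mul_of_nonneg_right (hm z hz) (by positivity)).trans hle

/-- Extending an interval by `1 / (n + 1)` of its length to the left. -/
lemma sub_le_of_iteratedDeriv_bounds {g : ℝ → ℝ} (hg : ContDiff ℝ ∞ g) {n : ℕ} {y h m M : ℝ}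
    (hh : 0 < h) (hm : 0 < m) (hmono : MonotoneOn g (Icc y (y + (n + 2) * h)))
    (hb : ∀ z ∈ Icc y (y + (n + 2) * h),
      m ≤ |iteratedDeriv (n + 1) g z| ∧ |iteratedDeriv (n + 1) g z| ≤ M) :
    g (y + h) - g y ≤ 2 ^ n * (1 + M / m) * (g (y + (n + 2) * h) - g (y + h)) := by
  set r := g (y + (n + 2) * h) - g (y + h) with hr
  have hn0 : 0 ≤ (n : ℝ) * h := by positivity
  have hsub : Icc (y + h) (y + h + (n + 1) * h) ⊆ Icc y (y + (n + 2) * h) :=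
    Icc_subset_Icc (by linarith) (by linarith)
  have hend : y + h + (n + 1) * h = y + (n + 2) * h := by ring
  have hgrow := le_sub_of_le_abs_iteratedDeriv hg hh (hmono.mono hsub) fun z hz ↦ (hb z (hsub hz)).1
  rw [hend, ← hr] at hgrow
  have hr0 : 0 ≤ r := sub_nonneg.2 <|
    hmono ⟨by linarith, by linarith⟩ ⟨by linarith, le_rfl⟩ (by linarith)
  obtain ⟨z, hz, hzeq⟩ := exists_fwdDiff_iter_eq_iteratedDeriv hh (n + 1) y hg
  push_cast at hz
  have hzM := (hb z ⟨hz.1, by linarith [hz.2]⟩).2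
  have hΔ : |(fwdDiff h)^[n] (fwdDiff h g) y| ≤ 2 ^ n * (M / m) * r := by
    rw [← Function.iterate_succ_apply, hzeq, abs_mul, abs_of_pos (pow_pos hh _)]
    have hM : 0 ≤ M := (abs_nonneg _).trans hzM
    calc h ^ (n + 1) * |iteratedDeriv (n + 1) g z| ≤ h ^ (n + 1) * M := by gcongr
      _ = M / m * (m * h ^ (n + 1)) := by field_simp
      _ ≤ M / m * (2 ^ n * r) := by gcongr
      _ = _ := by ring
  have hle := abs_le_abs_fwdDiff_iter_add (u := fwdDiff h g) (h := h) hr0 n y fun k hk hkn ↦ by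
    have hk1 : 1 * h ≤ (k : ℝ) * h := by
      gcongr
      exact_mod_cast hk
    have hkn' : (k : ℝ) * h ≤ n * h := by gcongr
    have e1 := hmono (a := y + h) (b := y + k * h) ⟨by linarith, by linarith⟩
      ⟨by linarith, by linarith⟩ (by linarith)
    have e2 := hmono (a := y + k * h) (b := y + k * h + h)
      ⟨by linarith, by linarith⟩ ⟨by linarith, by linarith⟩ (by linarith)
    have e3 := hmono (a := y + k * h + h) (b := y + (n + 2) * h)
      ⟨by linarith, by linarith⟩ ⟨by linarith, le_rfl⟩ (by linarith)
    rw [fwdDiff, abs_of_nonneg (by linarith)]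
    linarith
  calc g (y + h) - g y ≤ |fwdDiff h g y| := le_abs_self _
    _ ≤ _ := by linarith

lemma doubling_of_iteratedDeriv_bounds {g : ℝ → ℝ} (hg : ContDiff ℝ ∞ g) {n : ℕ} {x l m M : ℝ}
    (hl : 0 < l) (hm : 0 < m) (hM : 0 ≤ M) (hmono : MonotoneOn g (Icc (x - l) (x + l)))
    (hb : ∀ z ∈ Icc (x - l) (x + l),
      m ≤ |iteratedDeriv (n + 1) g z| ∧ |iteratedDeriv (n + 1) g z| ≤ M) :
    g x - g (x - l) ≤ (1 + 2 ^ n * (1 + M / m)) ^ (n + 1) * (g (x + l) - g x) := by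
  set A := 2 ^ n * (1 + M / m)
  have hA : 0 ≤ A := by positivity
  set h := l / (n + 1) with hh
  have hh0 : 0 < h := by positivity
  have hlh : (n + 1) * h = l := by rw [hh]; field_simp
  have key : ∀ j : ℕ, j ≤ n + 1 → g (x + l) - g (x - j * h) ≤ (1 + A) ^ j * (g (x + l) - g x) := by
    intro j
    induction j with
    | zero => simp
    | succ j ih =>
      intro hj
      have hj' : (j : ℝ) + 1 ≤ n + 1 := by exact_mod_cast hj
      have hjh : (j + 1 : ℝ) * h ≤ l := by
        rw [← hlh]
        gcongr
      have hj0 : 0 ≤ (j : ℝ) * h := by positivity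
      set y := x - (j + 1) * h with hy
      have hsub : Icc y (y + (n + 2) * h) ⊆ Icc (x - l) (x + l) :=
        Icc_subset_Icc (by linarith) (by linarith)
      have hstep := sub_le_of_iteratedDeriv_bounds hg hh0 hm (hmono.mono hsub)
        fun z hz ↦ hb z (hsub hz)
      have hyh : y + h = x - j * h := by rw [hy]; ring
      have htop : g (y + (n + 2) * h) ≤ g (x + l) :=
        hmono ⟨by linarith, by linarith⟩ ⟨by linarith, le_rfl⟩ (by linarith)
      rw [hyh] at hstep
      have h1 : A * (g (y + (n + 2) * h) - g (x - j * h)) ≤ A * (g (x + l) - g (x - j * h)) := by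
        gcongr
      have h2 := mul_le_mul_of_nonneg_left (ih (by omega)) (show 0 ≤ 1 + A by linarith)
      push_cast
      rw [pow_succ]
      linarith
  have hfin := key (n + 1) le_rfl
  push_cast at hfin
  rw [hlh] at hfin
  have : g x ≤ g (x + l) := hmono ⟨by linarith, by linarith⟩ ⟨by linarith, le_rfl⟩ (by linarith)
  linarith

/-- Quantitative non-flatness of `g` on `[a, b]`: at the scale `1 / N`, some derivative of order
at most `N` is bounded and bounded away from zero. -/
structure UniformlyNonflat (N : ℕ) (a b : ℝ) (g : ℝ → ℝ) : Prop where
  contDiff : ContDiff ℝ ∞ g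
  osc_le : ∀ x ∈ Icc a b, ∀ y ∈ Icc a b, g x - g y ≤ N
  nonflat : ∀ c ∈ Icc a b, ∃ n < N, ∀ y ∈ Icc a b, |y - c| ≤ 1 / N →
    1 / N ≤ |iteratedDeriv (n + 1) g y| ∧ |iteratedDeriv (n + 1) g y| ≤ N

lemma UniformlyNonflat.neg {N : ℕ} {a b : ℝ} {g : ℝ → ℝ} (hg : UniformlyNonflat N a b g) :
    UniformlyNonflat N a b (fun x ↦ -g x) where
  contDiff := hg.contDiff.neg
  osc_le x hx y hy := by linarith [hg.osc_le y hy x hx]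
  nonflat c hc := by simpa using hg.nonflat c hc

lemma UniformlyNonflat.comp_neg {N : ℕ} {a b : ℝ} {g : ℝ → ℝ} (hg : UniformlyNonflat N a b g) :
    UniformlyNonflat N (-b) (-a) (fun x ↦ g (-x)) where
  contDiff := hg.contDiff.comp contDiff_neg
  osc_le x hx y hy := hg.osc_le _ ⟨by linarith [hx.2], by linarith [hx.1]⟩ _
    ⟨by linarith [hy.2], by linarith [hy.1]⟩
  nonflat c hc := by
    obtain ⟨n, hn, h⟩ := hg.nonflat (-c) ⟨by linarith [hc.2], by linarith [hc.1]⟩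
    refine ⟨n, hn, fun y hy hyc ↦ ?_⟩
    have := h (-y) ⟨by linarith [hy.2], by linarith [hy.1]⟩
      (by rwa [← neg_sub', abs_neg])
    simpa [iteratedDeriv_comp_neg, abs_mul] using this

/-- The left-to-right half of the doubling condition, for all triples of points in `[p, q]`. -/
def DoublingOn (C : ℝ) (g : ℝ → ℝ) (p q : ℝ) : Prop :=
  ∀ u v w, p ≤ u → u ≤ v → v ≤ w → w ≤ q → v - u ≤ w - v → g v - g u ≤ C * (g w - g v)

lemma UniformlyNonflat.exists_doublingOn (N : ℕ) : ∃ C : ℝ, 0 < C ∧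
    ∀ (a b : ℝ) (g : ℝ → ℝ), UniformlyNonflat N a b g → ∀ p q : ℝ, Icc p q ⊆ Icc a b →
      MonotoneOn g (Icc p q) → DoublingOn C g p q := by
  rcases Nat.eq_zero_or_pos N with rfl | hN
  · refine ⟨1, one_pos, fun a b g hg p q hpq _ u v w hu huv hvw hw _ ↦ ?_⟩
    obtain ⟨n, hn, -⟩ := hg.nonflat v (hpq ⟨hu.trans huv, hvw.trans hw⟩)
    omega
  have hN1 : (1 : ℝ) ≤ N := by exact_mod_cast hN
  have hN0 : (0 : ℝ) < N := by linarith
  set κ : ℝ := 1 / N * (1 / (N * N)) ^ N / 2 ^ N with hκ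
  have hκ0 : 0 < κ := by positivity
  set C₁ : ℝ := (1 + 2 ^ N * (1 + N / (1 / N))) ^ N with hC₁
  have hC₁0 : 0 < C₁ := by positivity
  refine ⟨C₁ + N / κ, by positivity, fun a b g hg p q hpq hmono' u v w hu huv hvw hw hle ↦ ?_⟩
  have hsub : Icc u w ⊆ Icc a b := (Icc_subset_Icc hu hw).trans hpq
  have hmono : MonotoneOn g (Icc u w) := hmono'.mono (Icc_subset_Icc hu hw)
  obtain ⟨n, hn, hbd⟩ := hg.nonflat v (hsub ⟨huv, hvw⟩)
  have hgvw : g v ≤ g w := hmono ⟨huv, hvw⟩ ⟨huv.trans hvw, le_rfl⟩ hvw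
  rcases huv.eq_or_lt with rfl | huv'
  · rw [sub_self]
    exact mul_nonneg (by positivity) (by linarith)
  rcases le_or_gt (v - u) (1 / N) with hsmall | hlarge
  · have hsub' : Icc (v - (v - u)) (v + (v - u)) ⊆ Icc u w :=
      Icc_subset_Icc (by linarith) (by linarith)
    have hd := doubling_of_iteratedDeriv_bounds hg.contDiff (n := n) (sub_pos.2 huv')
      (show (0 : ℝ) < 1 / N by positivity) hN0.le (hmono.mono hsub') fun z hz ↦
        hbd z (hsub (hsub' hz)) (abs_le.2 ⟨by linarith [hz.1], by linarith [hz.2]⟩)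
    rw [sub_sub_cancel] at hd
    have htop : g (v + (v - u)) ≤ g w :=
      hmono ⟨by linarith, by linarith⟩ ⟨huv.trans hvw, le_rfl⟩ (by linarith)
    have hC : (1 + 2 ^ n * (1 + (N : ℝ) / (1 / N))) ^ (n + 1) ≤ C₁ := by
      have h0 : (0 : ℝ) ≤ N / (1 / N) := by positivity
      calc (1 + 2 ^ n * (1 + (N : ℝ) / (1 / N))) ^ (n + 1)
          ≤ (1 + 2 ^ N * (1 + (N : ℝ) / (1 / N))) ^ (n + 1) := by
            gcongr
            norm_num
        _ ≤ C₁ := pow_le_pow_right₀ (le_add_of_nonneg_right (by positivity)) hn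
    have hlow : g v ≤ g (v + (v - u)) := hmono ⟨huv, hvw⟩ ⟨by linarith, by linarith⟩ (by linarith)
    refine hd.trans (mul_le_mul (hC.trans ?_) (by linarith) (by linarith) (by positivity))
    linarith [show 0 ≤ N / κ by positivity]
  · set h : ℝ := 1 / N / (n + 1) with hh
    have hh0 : 0 < h := by positivity
    have hnh : (n + 1) * h = 1 / N := by rw [hh]; field_simp
    have hsub' : Icc v (v + (n + 1) * h) ⊆ Icc u w :=
      Icc_subset_Icc huv (by rw [hnh]; linarith)
    have hgrow := le_sub_of_le_abs_iteratedDeriv hg.contDiff hh0 (hmono.mono hsub') fun z hz ↦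
      (hbd z (hsub (hsub' hz)) (by
        rw [hnh] at hz
        exact abs_le.2 ⟨by linarith [hz.1, hz.2], by linarith [hz.2]⟩)).1
    rw [hnh] at hgrow
    have hscale : 0 < 1 / (N : ℝ) := by positivity
    have htop : g (v + 1 / N) ≤ g w :=
      hmono ⟨by linarith, by linarith⟩ ⟨huv.trans hvw, le_rfl⟩ (by linarith)
    have hlow : κ ≤ g w - g v := by
      have hnN : (n + 1 : ℝ) ≤ N := by exact_mod_cast hn
      have h1 : 1 / (N * N : ℝ) ≤ h := by
        rw [hh, div_div]
        gcongr
      have h2 : (1 / (N * N : ℝ)) ^ N ≤ h ^ (n + 1) := by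
        calc (1 / (N * N : ℝ)) ^ N ≤ (1 / (N * N : ℝ)) ^ (n + 1) :=
              pow_le_pow_of_le_one (by positivity)
                (by rw [div_le_one (by positivity)]; nlinarith) hn
          _ ≤ h ^ (n + 1) := by gcongr
      rw [hκ, div_le_iff₀ (by positivity)]
      calc 1 / (N : ℝ) * (1 / (N * N)) ^ N ≤ 1 / N * h ^ (n + 1) := by gcongr
        _ ≤ 2 ^ n * (g (v + 1 / N) - g v) := hgrow
        _ ≤ 2 ^ n * (g w - g v) := by gcongr
        _ ≤ 2 ^ N * (g w - g v) := by
          gcongr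
          norm_num
        _ = _ := mul_comm _ _
    have hosc := hg.osc_le v (hsub ⟨huv, hvw⟩) u (hsub ⟨le_rfl, huv.trans hvw⟩)
    calc g v - g u ≤ N := hosc
      _ = N / κ * κ := by field_simp
      _ ≤ (C₁ + N / κ) * (g w - g v) := by
        gcongr
        linarith

lemma DoublingOn.sub_le_pow_mul {C p q : ℝ} {g : ℝ → ℝ} (hC : 0 < C) (hd : DoublingOn C g p q)
    (n : ℕ) {u v w : ℝ} (hu : p ≤ u) (huv : u ≤ v) (hvw : v ≤ w) (hw : w ≤ q)
    (h : v - u ≤ 2 ^ n * (w - v)) : g w - g u ≤ (1 + C) ^ (n + 1) * (g w - g v) := by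
  induction n generalizing v with
  | zero =>
    have := hd u v w hu huv hvw hw (by simpa using h)
    rw [zero_add, pow_one]
    linarith
  | succ n ih =>
    by_cases hcase : v - u ≤ w - v
    · have h1 := hd u v w hu huv hvw hw hcase
      have h0 : 0 ≤ g w - g v := by
        have := hd v v w (hu.trans huv) le_rfl hvw hw (by linarith)
        rw [sub_self] at this
        exact nonneg_of_mul_nonneg_right this hC
      calc g w - g u ≤ (1 + C) * (g w - g v) := by linarith
        _ ≤ (1 + C) ^ (n + 1 + 1) * (g w - g v) := by
          gcongr
          exact le_self_pow₀ (by linarith) (by omega)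
    · push Not at hcase
      have h1 := hd (v - (w - v)) v w (by linarith) (by linarith) hvw hw (by linarith)
      have h2 := ih (v := v - (w - v)) (by linarith) (by linarith) (by rw [pow_succ] at h; linarith)
      calc g w - g u ≤ (1 + C) ^ (n + 1) * (g w - g (v - (w - v))) := h2
        _ ≤ (1 + C) ^ (n + 1) * ((1 + C) * (g w - g v)) := by
          gcongr
          linarith
        _ = _ := by ring

lemma DoublingOn.pow_mul_le {C p q : ℝ} {g : ℝ → ℝ} (hC : 0 < C) (hd : DoublingOn C g p q)
    (hmono : MonotoneOn g (Icc p q)) (n : ℕ) {u v w : ℝ} (hu : p ≤ u) (huv : u ≤ v) (hvw : v ≤ w)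
    (hw : w ≤ q) (h : 2 ^ n * (v - u) ≤ w - u) : (1 + 1 / C) ^ n * (g v - g u) ≤ g w - g u := by
  induction n generalizing v with
  | zero =>
    have := hmono ⟨hu.trans huv, hvw.trans hw⟩ ⟨hu.trans (huv.trans hvw), hw⟩ hvw
    simpa using this
  | succ n ih =>
    have h2n : (1 : ℝ) ≤ 2 ^ n := one_le_pow₀ (by norm_num)
    have hvw' : v + (v - u) ≤ w := by
      rw [pow_succ] at h
      nlinarith
    have h1 := ih (v := v + (v - u)) (by linarith) hvw' (by rw [pow_succ] at h; linarith)
    have h2 := hd u v (v + (v - u)) hu huv (by linarith) (hvw'.trans hw) (by linarith)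
    rw [← div_le_iff₀' hC] at h2
    calc (1 + 1 / C) ^ (n + 1) * (g v - g u)
        = (1 + 1 / C) ^ n * (g v - g u + (g v - g u) / C) := by ring
      _ ≤ (1 + 1 / C) ^ n * (g (v + (v - u)) - g u) := by
        gcongr
        linarith
      _ ≤ _ := h1

lemma UniformlyNonflat.exists_ratio_bound (N : ℕ) (e : ℝ) : ∃ d : ℝ, 0 ≤ d ∧
    ∀ (a b : ℝ) (g : ℝ → ℝ), UniformlyNonflat N a b g → ∀ u v w : ℝ, u < v → v < w →
      Icc u w ⊆ Icc a b → StrictMonoOn g (Icc u w) → g w - g v ≤ e * (g v - g u) →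
      w - v ≤ d * (v - u) := by
  obtain ⟨C, hC, hd⟩ := UniformlyNonflat.exists_doublingOn N
  obtain ⟨n, hn⟩ := pow_unbounded_of_one_lt (1 + e) (show 1 < 1 + 1 / C by simpa using hC)
  refine ⟨2 ^ n, by positivity, fun a b g hg u v w huv hvw hsub hmono hle ↦ ?_⟩
  by_contra! hcon
  have h1 := (hd a b g hg u w hsub hmono.monotoneOn).pow_mul_le hC hmono.monotoneOn n
    le_rfl huv.le hvw.le le_rfl (by linarith)
  have h2 := hmono ⟨le_rfl, (huv.trans hvw).le⟩ ⟨huv.le, hvw.le⟩ huv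
  linarith [mul_lt_mul_of_pos_right hn (sub_pos.2 h2)]

lemma UniformlyNonflat.exists_ratio_small (N : ℕ) {d : ℝ} (hd0 : 0 < d) : ∃ e : ℝ, 0 < e ∧
    ∀ (a b : ℝ) (g : ℝ → ℝ), UniformlyNonflat N a b g → ∀ u v w : ℝ, u < v → v < w →
      Icc u w ⊆ Icc a b → StrictMonoOn g (Icc u w) → g w - g v ≤ e * (g v - g u) →
      w - v ≤ d * (v - u) := by
  obtain ⟨C, hC, hd⟩ := UniformlyNonflat.exists_doublingOn N
  obtain ⟨n, hn⟩ := pow_unbounded_of_one_lt (1 / d) one_lt_two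
  rw [div_lt_iff₀ hd0] at hn
  have hA : 0 < (1 + C) ^ (n + 1) := by positivity
  refine ⟨1 / (1 + C) ^ (n + 1), by positivity, fun a b g hg u v w huv hvw hsub hmono hle ↦ ?_⟩
  by_contra! hcon
  have hscale : v - u ≤ 2 ^ n * (w - v) :=
    calc v - u ≤ 2 ^ n * d * (v - u) := le_mul_of_one_le_left (by linarith) hn.le
      _ = 2 ^ n * (d * (v - u)) := by ring
      _ ≤ 2 ^ n * (w - v) := by gcongr
  have h1 := (hd a b g hg u w hsub hmono.monotoneOn).sub_le_pow_mul hC n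
    le_rfl huv.le hvw.le le_rfl hscale
  have h2 := hmono ⟨huv.le, hvw.le⟩ ⟨(huv.trans hvw).le, le_rfl⟩ hvw
  rw [one_div_mul_eq_div, le_div_iff₀' hA] at hle
  linarith

lemma crossRatio_eq_add {t1 j1 j2 t2 : ℝ} (h1 : t1 < j1) (h2 : j2 < t2) :
    crossRatio t1 j1 j2 t2 = (j2 - j1) / (j1 - t1) + (j2 - j1) / (t2 - j2) +
      (j2 - j1) / (j1 - t1) * ((j2 - j1) / (t2 - j2)) := by
  have h1' : j1 - t1 ≠ 0 := (sub_pos.2 h1).ne'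
  have h2' : t2 - j2 ≠ 0 := (sub_pos.2 h2).ne'
  rw [crossRatio]
  field_simp
  ring

lemma crossRatio_neg (t1 j1 j2 t2 : ℝ) :
    crossRatio (-t1) (-j1) (-j2) (-t2) = crossRatio t1 j1 j2 t2 := by
  unfold crossRatio
  congr 1 <;> ring

lemma crossRatio_pos {t1 j1 j2 t2 : ℝ} (h1 : t1 < j1) (h : j1 < j2) (h2 : j2 < t2) :
    0 < crossRatio t1 j1 j2 t2 :=
  div_pos (mul_pos (by linarith) (by linarith)) (mul_pos (by linarith) (by linarith))

/-- Passing from control of one-sided ratios to control of cross-ratios. -/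
lemma crossRatio_le_of_ratio_le {N : ℕ} {e d : ℝ} (hd : 0 ≤ d)
    (H : ∀ (a b : ℝ) (g : ℝ → ℝ), UniformlyNonflat N a b g → ∀ u v w : ℝ, u < v → v < w →
      Icc u w ⊆ Icc a b → StrictMonoOn g (Icc u w) → g w - g v ≤ e * (g v - g u) →
      w - v ≤ d * (v - u))
    {a b : ℝ} {g : ℝ → ℝ} (hg : UniformlyNonflat N a b g) {t1 j1 j2 t2 : ℝ} (h1 : t1 < j1)
    (h12 : j1 < j2) (h2 : j2 < t2) (hsub : Icc t1 t2 ⊆ Icc a b)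
    (hmono : StrictMonoOn g (Icc t1 t2) ∨ StrictAntiOn g (Icc t1 t2))
    (he : crossRatio (g t1) (g j1) (g j2) (g t2) ≤ e) :
    crossRatio t1 j1 j2 t2 ≤ d + d + d * d := by
  wlog hm : StrictMonoOn g (Icc t1 t2) generalizing g
  · exact this hg.neg (.inl (hmono.resolve_left hm).neg) (by rwa [crossRatio_neg])
      (hmono.resolve_left hm).neg
  have m1 : t1 ∈ Icc t1 t2 := ⟨by linarith, by linarith⟩
  have m2 : j1 ∈ Icc t1 t2 := ⟨by linarith, by linarith⟩
  have m3 : j2 ∈ Icc t1 t2 := ⟨by linarith, by linarith⟩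
  have m4 : t2 ∈ Icc t1 t2 := ⟨by linarith, by linarith⟩
  have g1 := hm m1 m2 h1
  have g2 := hm m2 m3 h12
  have g3 := hm m3 m4 h2
  have X0 : 0 < (g j2 - g j1) / (g j1 - g t1) := div_pos (sub_pos.2 g2) (sub_pos.2 g1)
  have Y0 : 0 < (g j2 - g j1) / (g t2 - g j2) := div_pos (sub_pos.2 g2) (sub_pos.2 g3)
  have XY0 := mul_pos X0 Y0
  rw [crossRatio_eq_add g1 g3] at he
  have hleft : j2 - j1 ≤ d * (j1 - t1) := by
    have hs : Icc t1 j2 ⊆ Icc t1 t2 := Icc_subset_Icc le_rfl h2.le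
    refine H a b g hg t1 j1 j2 h1 h12 (hs.trans hsub) (hm.mono hs) ?_
    rw [← div_le_iff₀ (sub_pos.2 g1)]
    linarith
  have hright : -j1 - -j2 ≤ d * (-j2 - -t2) := by
    have hs : ∀ x ∈ Icc (-t2) (-j1), -x ∈ Icc t1 t2 := fun x hx ↦
      ⟨by linarith [hx.2], by linarith [hx.1]⟩
    refine H (-b) (-a) (fun x ↦ -g (-x)) hg.comp_neg.neg (-t2) (-j2) (-j1) (by linarith)
      (by linarith) (fun x hx ↦ ?_) (fun x hx y hy hxy ↦ ?_) ?_
    · have := hsub (hs x hx)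
      exact ⟨by linarith [this.2], by linarith [this.1]⟩
    · exact neg_lt_neg (hm (hs y hy) (hs x hx) (neg_lt_neg hxy))
    · simp only [neg_neg]
      have hY : (g j2 - g j1) / (g t2 - g j2) ≤ e := by linarith
      rw [div_le_iff₀ (sub_pos.2 g3)] at hY
      linarith
  have hx : (j2 - j1) / (j1 - t1) ≤ d := (div_le_iff₀ (sub_pos.2 h1)).2 hleft
  have hy : (j2 - j1) / (t2 - j2) ≤ d := (div_le_iff₀ (sub_pos.2 h2)).2 (by linarith)
  have y0 : 0 ≤ (j2 - j1) / (t2 - j2) := div_nonneg (by linarith) (by linarith)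
  rw [crossRatio_eq_add h1 h2]
  gcongr

/-- A relation which is bounded over bounded sets and small over small numbers is dominated by a
function which tends to zero at zero. -/
lemma exists_modulus {S : ℝ → ℝ → Prop} (hpos : ∀ e D, S e D → 0 < e ∧ 0 ≤ D)
    (hbdd : ∀ e, ∃ B, ∀ e' D, S e' D → e' ≤ e → D ≤ B)
    (hsmall : ∀ δ > 0, ∃ e > 0, ∀ e' D, S e' D → e' ≤ e → D ≤ δ) :
    ∃ ρ : ℝ → ℝ, (∀ e D, S e D → D < ρ e) ∧ Tendsto ρ (𝓝[>] 0) (𝓝 0) := by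
  set s : ℝ → Set ℝ := fun e ↦ {D | ∃ e' ≤ e, S e' D} with hs
  have hs0 : ∀ e, 0 ≤ sSup (s e) := fun e ↦
    Real.sSup_nonneg fun D ⟨e', _, hD⟩ ↦ (hpos e' D hD).2
  refine ⟨fun e ↦ sSup (s e) + e, fun e D hD ↦ ?_, ?_⟩
  · obtain ⟨B, hB⟩ := hbdd e
    have : D ≤ sSup (s e) := le_csSup ⟨B, fun D' ⟨e', he', hD'⟩ ↦ hB e' D' hD' he'⟩ ⟨e, le_rfl, hD⟩
    linarith [(hpos e D hD).1]
  · rw [Metric.tendsto_nhdsWithin_nhds]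
    intro δ hδ
    obtain ⟨e, he, h⟩ := hsmall (δ / 2) (half_pos hδ)
    refine ⟨min e (δ / 2), lt_min he (half_pos hδ), fun {x} hx hdist ↦ ?_⟩
    have hx0 : 0 < x := hx
    rw [Real.dist_eq, sub_zero, abs_of_pos hx0] at hdist
    have hxe := hdist.trans_le (min_le_left _ _)
    have hxδ := hdist.trans_le (min_le_right _ _)
    have hle : sSup (s x) ≤ δ / 2 :=
      Real.sSup_le (fun D ⟨e', he', hD⟩ ↦ h e' D hD (he'.trans hxe.le)) (half_pos hδ).le
    rw [Real.dist_eq, sub_zero, abs_of_nonneg (add_nonneg (hs0 x) hx0.le)]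
    linarith

/-- By compactness, a map all of whose points have a nonvanishing derivative of some order is
uniformly non-flat. -/
lemma exists_uniform_iteratedDeriv_bounds {f : ℝ → ℝ} (hf : ContDiff ℝ ∞ f) {K : Set ℝ}
    (hK : IsCompact K) (hnf : ∀ c ∈ K, ∃ n : ℕ, iteratedDeriv (n + 1) f c ≠ 0) :
    ∃ N : ℕ, ∀ c ∈ K, ∃ n < N, ∀ y, |y - c| ≤ 1 / (N + 1) →
      1 / (N + 1) ≤ |iteratedDeriv (n + 1) f y| ∧ |iteratedDeriv (n + 1) f y| ≤ N := by
  have hmonoN : ∀ (N N' : ℕ) (c : ℝ), N ≤ N' → (∃ n < N, ∀ y, |y - c| ≤ 1 / (N + 1) →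
      1 / (N + 1) ≤ |iteratedDeriv (n + 1) f y| ∧ |iteratedDeriv (n + 1) f y| ≤ N) →
      ∃ n < N', ∀ y, |y - c| ≤ 1 / (N' + 1) →
      1 / (N' + 1) ≤ |iteratedDeriv (n + 1) f y| ∧ |iteratedDeriv (n + 1) f y| ≤ N' := by
    rintro N N' c hN ⟨n, hn, h⟩
    have hN' : (N : ℝ) ≤ N' := by exact_mod_cast hN
    have hinv : 1 / ((N' : ℝ) + 1) ≤ 1 / (N + 1) := by gcongr
    exact ⟨n, hn.trans_le hN, fun y hy ↦
      ⟨hinv.trans (h y (hy.trans hinv)).1, (h y (hy.trans hinv)).2.trans hN'⟩⟩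
  refine hK.induction_on
    (p := fun S ↦ ∃ N : ℕ, ∀ c ∈ S, ∃ n < N, ∀ y, |y - c| ≤ 1 / (N + 1) →
      1 / (N + 1) ≤ |iteratedDeriv (n + 1) f y| ∧ |iteratedDeriv (n + 1) f y| ≤ N) ?_ ?_ ?_ ?_
  · exact ⟨0, by simp⟩
  · exact fun S T hST ⟨N, hN⟩ ↦ ⟨N, fun c hc ↦ hN c (hST hc)⟩
  · rintro S T ⟨N, hN⟩ ⟨N', hN'⟩
    refine ⟨max N N', fun c hc ↦ ?_⟩
    exact hc.elim (fun h ↦ hmonoN _ _ c (le_max_left _ _) (hN c h))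
      fun h ↦ hmonoN _ _ c (le_max_right _ _) (hN' c h)
  · intro c hc
    obtain ⟨n, hn⟩ := hnf c hc
    have hcont : Continuous fun y ↦ |iteratedDeriv (n + 1) f y| :=
      (hf.continuous_iteratedDeriv (n + 1) (by exact_mod_cast le_top)).abs
    set A := |iteratedDeriv (n + 1) f c| with hA
    have hA0 : 0 < A := abs_pos.2 hn
    obtain ⟨r, hr, hball⟩ := Metric.eventually_nhds_iff.1 <|
      (hcont.continuousAt (x := c)).eventually (Ioo_mem_nhds (half_lt_self hA0) (lt_add_one A))
    obtain ⟨N, hN⟩ := exists_nat_gt (max (n + 1 : ℝ) (max (A + 1) (max (2 / r) (2 / A))))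
    simp only [max_lt_iff] at hN
    obtain ⟨hN1, hN2, hN3, hN4⟩ := hN
    have hnN : n < N := by
      have : (n : ℝ) < N := by linarith
      exact_mod_cast this
    have hNA : 1 / (N + 1 : ℝ) ≤ A / 2 := by
      rw [div_lt_iff₀ hA0] at hN4
      rw [div_le_div_iff₀ (by positivity) two_pos]
      nlinarith
    have hNr : 1 / (N + 1 : ℝ) < r / 2 := by
      rw [div_lt_iff₀ hr] at hN3
      rw [div_lt_div_iff₀ (by positivity) two_pos]
      nlinarith
    refine ⟨Metric.ball c (r / 2), mem_nhdsWithin_of_mem_nhds (Metric.ball_mem_nhds c (half_pos hr)),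
      N, fun c' hc' ↦ ⟨n, hnN, fun y hy ↦ ?_⟩⟩
    have hyc : dist y c < r := by
      have h1 := dist_triangle y c' c
      rw [Metric.mem_ball] at hc'
      rw [← Real.dist_eq] at hy
      linarith
    have := hball hyc
    exact ⟨hNA.trans this.1.le, (this.2.trans hN2).le⟩

/-- Uniform non-flatness holds on a `C^k` neighbourhood of a map with non-flat critical points. -/
lemma exists_uniformlyNonflat_of_ckClose {a b : ℝ} {f : ℝ → ℝ} (hf : ContDiff ℝ ∞ f)
    (hnf : ∀ c ∈ Icc a b, ∃ n : ℕ, iteratedDeriv (n + 1) f c ≠ 0) :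
    ∃ (N k : ℕ) (η : ℝ), 0 < η ∧ ∀ g : ℝ → ℝ, ContDiff ℝ ∞ g → MapsTo g (Icc a b) (Icc a b) →
      CkClose k f g (Icc a b) η → UniformlyNonflat N a b g := by
  obtain ⟨N, hN⟩ := exists_uniform_iteratedDeriv_bounds hf isCompact_Icc hnf
  set P := max (2 * (N + 1)) ⌈b - a⌉₊ with hP
  have hP1 : (2 * (N + 1) : ℝ) ≤ P := by exact_mod_cast le_max_left _ _
  have hP2 : b - a ≤ P := (Nat.le_ceil _).trans (by exact_mod_cast le_max_right _ _)
  have hNP : N ≤ P := le_trans (by omega) (le_max_left _ _)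
  have hη : 1 / (2 * (N + 1) : ℝ) = 1 / (N + 1) / 2 := by field_simp
  have hη1 : 1 / (N + 1 : ℝ) ≤ 1 := by
    rw [div_le_one (by positivity)]
    linarith [Nat.cast_nonneg (α := ℝ) N]
  have hPη : 1 / (P : ℝ) ≤ 1 / (N + 1) / 2 := by
    rw [← hη]
    gcongr
  have hη0 : 0 < 1 / (N + 1 : ℝ) := by positivity
  refine ⟨P, N, 1 / (N + 1) / 2, by positivity, fun g hg hmaps hclose ↦ ⟨hg, ?_, ?_⟩⟩
  · intro x hx y hy
    linarith [(hmaps hx).2, (hmaps hy).1]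
  · intro c hc
    obtain ⟨n, hn, h⟩ := hN c hc
    refine ⟨n, hn.trans_le hNP, fun y hy hyc ↦ ?_⟩
    obtain ⟨h1, h2⟩ := h y (by linarith)
    have hcl := hclose (n + 1) hn y hy
    have h3 := abs_sub_abs_le_abs_sub (iteratedDeriv (n + 1) g y) (iteratedDeriv (n + 1) f y)
    have h4 := abs_sub_abs_le_abs_sub (iteratedDeriv (n + 1) f y) (iteratedDeriv (n + 1) g y)
    rw [abs_sub_comm] at h4
    exact ⟨by linarith, by linarith [Nat.cast_nonneg (α := ℝ) N]⟩

/-- Uniform cross-ratio bound for one iterate: for a C^∞ map `f` with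
non-flat critical points there are a C^∞ neighbourhood `F` and a function `ρ(ε)` such that
for `g ∈ F` and intervals `J ⊂ T` on which `g` is a diffeomorphism,
`D(T,J) < ρ(D(g(T),g(J)))`; moreover `ρ(ε) → 0` as `ε → 0`. -/
theorem stmt_16 (a b : ℝ) (hab : a < b) (f : ℝ → ℝ)
    (hf : ∀ n : ℕ, ContDiff ℝ n f) (hmaps : MapsTo f (Icc a b) (Icc a b))
    (hnf : ∀ c ∈ Icc a b, deriv f c = 0 → ∃ d : ℕ, 2 ≤ d ∧ iteratedDeriv d f c ≠ 0) :
    ∃ (k : ℕ) (η : ℝ) (ρ : ℝ → ℝ), 0 < η ∧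
      (∀ g : ℝ → ℝ, (∀ n : ℕ, ContDiff ℝ n g) → MapsTo g (Icc a b) (Icc a b) →
        CkClose k f g (Icc a b) η →
        ∀ t1 j1 j2 t2 : ℝ, t1 < j1 → j1 < j2 → j2 < t2 → Icc t1 t2 ⊆ Icc a b →
          (StrictMonoOn g (Icc t1 t2) ∨ StrictAntiOn g (Icc t1 t2)) →
          crossRatio t1 j1 j2 t2 < ρ (crossRatio (g t1) (g j1) (g j2) (g t2))) ∧
      Tendsto ρ (nhdsWithin 0 (Ioi 0)) (nhds 0) := by
  have hf' : ContDiff ℝ ∞ f := contDiff_infty.2 hf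
  have hnf' : ∀ c ∈ Icc a b, ∃ n : ℕ, iteratedDeriv (n + 1) f c ≠ 0 := by
    intro c hc
    by_cases h0 : deriv f c = 0
    · obtain ⟨d, hd, hdc⟩ := hnf c hc h0
      exact ⟨d - 1, by rwa [Nat.sub_add_cancel (by omega)]⟩
    · exact ⟨0, by rwa [zero_add, iteratedDeriv_one]⟩
  obtain ⟨N, k, η, hη, hclass⟩ := exists_uniformlyNonflat_of_ckClose hf' hnf'
  obtain ⟨ρ, hρ, hlim⟩ := exists_modulus
    (S := fun e D ↦ ∃ g : ℝ → ℝ, UniformlyNonflat N a b g ∧ ∃ t1 j1 j2 t2 : ℝ,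
      t1 < j1 ∧ j1 < j2 ∧ j2 < t2 ∧ Icc t1 t2 ⊆ Icc a b ∧
      (StrictMonoOn g (Icc t1 t2) ∨ StrictAntiOn g (Icc t1 t2)) ∧
      e = crossRatio (g t1) (g j1) (g j2) (g t2) ∧ D = crossRatio t1 j1 j2 t2)
    (by
      rintro e D ⟨g, -, t1, j1, j2, t2, h1, h12, h2, -, hm, rfl, rfl⟩
      refine ⟨?_, (crossRatio_pos h1 h12 h2).le⟩
      have m1 : t1 ∈ Icc t1 t2 := ⟨by linarith, by linarith⟩
      have m2 : j1 ∈ Icc t1 t2 := ⟨by linarith, by linarith⟩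
      have m3 : j2 ∈ Icc t1 t2 := ⟨by linarith, by linarith⟩
      have m4 : t2 ∈ Icc t1 t2 := ⟨by linarith, by linarith⟩
      rcases hm with hm | hm
      · exact crossRatio_pos (hm m1 m2 h1) (hm m2 m3 h12) (hm m3 m4 h2)
      · rw [← crossRatio_neg]
        exact crossRatio_pos (neg_lt_neg (hm m1 m2 h1)) (neg_lt_neg (hm m2 m3 h12))
          (neg_lt_neg (hm m3 m4 h2)))
    (by
      intro e
      obtain ⟨d, hd, H⟩ := UniformlyNonflat.exists_ratio_bound N e
      refine ⟨d + d + d * d, ?_⟩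
      rintro e' D ⟨g, hg, t1, j1, j2, t2, h1, h12, h2, hsub, hm, rfl, rfl⟩ he
      exact crossRatio_le_of_ratio_le hd H hg h1 h12 h2 hsub hm he)
    (by
      intro δ hδ
      have hd : 0 < min (δ / 3) 1 := lt_min (by positivity) one_pos
      obtain ⟨e, he0, H⟩ := UniformlyNonflat.exists_ratio_small N hd
      refine ⟨e, he0, ?_⟩
      rintro e' D ⟨g, hg, t1, j1, j2, t2, h1, h12, h2, hsub, hm, rfl, rfl⟩ he
      refine (crossRatio_le_of_ratio_le hd.le H hg h1 h12 h2 hsub hm he).trans ?_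
      nlinarith [min_le_left (δ / 3) 1, min_le_right (δ / 3) 1])
  refine ⟨k, η, ρ, hη, fun g hg hmaps hclose t1 j1 j2 t2 h1 h12 h2 hsub hm ↦ ?_, hlim⟩
  exact hρ _ _ ⟨g, hclass g (contDiff_infty.2 hg) hmaps hclose, t1, j1, j2, t2, h1, h12, h2,
    hsub, hm, rfl, rfl⟩
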